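/- For every integer d ≥ 1 and every real t > 8·√d·(d·⌈(1/2)·log₂ d⌉ + d + 1) + 1, there exists a constant C (depending only on d and t) such that the following holds: for every integer k ≥ 2, every finite set S of n points in ℝ^d, and every partition of S into k subsets C_1, …, C_k, there exists a subgraph G = (S, E) of the complete k-partite geometric graph K_{C_1…C_k} with at most C·n edges such that G is a t-spanner of K_{C_1…C_k}, i.e., δ_E(p,q) ≤ t·δ_K(p,q) for all p, q ∈ S. -/

import Mathlib

open scoped ENNReal

/-- The length of a walk, given as the list of its vertices: the sum of the
Euclidean distances between consecutive vertices. -/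
noncomputable def walkLen {P : Type*} [PseudoEMetricSpace P] (xs : List P) : ℝ≥0∞ :=
  (List.zipWith edist xs xs.tail).sum

/-- `xs` is a walk from `p` to `q` in the graph with edge set `E`:
a nonempty finite sequence starting at `p`, ending at `q`, each consecutive
unordered pair being an edge of `E`. -/
def IsWalk {P : Type*} (E : Set (Sym2 P)) (p q : P) (xs : List P) : Prop :=
  xs.head? = some p ∧ xs.getLast? = some q ∧ xs.Chain' (fun a b => s(a, b) ∈ E)

/-- Graph distance: the infimum of lengths of walks from `p` to `q`
(`∞` if no walk exists). -/
noncomputable def gdist {P : Type*} [PseudoEMetricSpace P] (E : Set (Sym2 P)) (p q : P) :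
    ℝ≥0∞ :=
  ⨅ (xs : List P) (_ : IsWalk E p q xs), walkLen xs

/-- The edge set of the complete `k`-partite geometric graph whose color
classes are `C 0, …, C (k-1)`: all unordered pairs of points lying in two
different classes. -/
def kpartiteEdges {P : Type*} {k : ℕ} (C : Fin k → Set P) : Set (Sym2 P) :=
  {e | ∃ p q : P, e = s(p, q) ∧ ∃ i j : Fin k, i ≠ j ∧ p ∈ C i ∧ q ∈ C j}

section GraphDistance

variable {P : Type*} {E : Set (Sym2 P)} {p q r : P}

theorem isWalk_iff {xs : List P} : IsWalk E p q xs ↔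
    xs.head? = some p ∧ xs.getLast? = some q ∧ xs.IsChain fun a b => s(a, b) ∈ E :=
  Iff.rfl

theorem isWalk_singleton (p : P) : IsWalk E p p [p] := by
  simp [isWalk_iff]

theorem isWalk_cons_cons {a b : P} {l : List P} :
    IsWalk E p q (a :: b :: l) ↔ a = p ∧ s(a, b) ∈ E ∧ IsWalk E b q (b :: l) := by
  simp [isWalk_iff]
  tauto

/-- Induction on a walk, from its last vertex backwards. -/
theorem IsWalk.induct {motive : P → List P → Prop} (single : motive q [q])
    (cons : ∀ a b l, s(a, b) ∈ E → motive b (b :: l) → motive a (a :: b :: l)) :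
    ∀ {xs : List P} {p : P}, IsWalk E p q xs → motive p xs
  | [], p, h => by simp [isWalk_iff] at h
  | [a], p, h => by
    obtain ⟨rfl, rfl⟩ : a = p ∧ a = q := by simpa [isWalk_iff] using h
    exact single
  | a :: b :: l, p, h => by
    obtain ⟨rfl, hab, hw⟩ := isWalk_cons_cons.1 h
    exact cons a b l hab (IsWalk.induct single cons hw)

variable [PseudoEMetricSpace P]

theorem walkLen_cons_cons (a b : P) (l : List P) :
    walkLen (a :: b :: l) = edist a b + walkLen (b :: l) := by
  simp [walkLen]

theorem gdist_self (E : Set (Sym2 P)) (p : P) : gdist E p p = 0 :=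
  le_antisymm ((iInf₂_le [p] (isWalk_singleton p)).trans (by simp [walkLen])) zero_le

theorem gdist_le_edist_add (h : s(p, q) ∈ E) : gdist E p r ≤ edist p q + gdist E q r := by
  simp only [gdist, ENNReal.add_iInf]
  refine le_iInf₂ fun xs hxs => ?_
  match xs, hxs with
  | [], hxs => simp [isWalk_iff] at hxs
  | b :: l, hxs =>
    obtain rfl : b = q := by simpa using hxs.1
    rw [← walkLen_cons_cons]
    exact iInf₂_le _ (isWalk_cons_cons.2 ⟨rfl, h, hxs⟩)

theorem gdist_le_edist (h : s(p, q) ∈ E) : gdist E p q ≤ edist p q := by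
  simpa [gdist_self] using gdist_le_edist_add (r := q) h

theorem gdist_triangle (E : Set (Sym2 P)) (p q r : P) :
    gdist E p r ≤ gdist E p q + gdist E q r := by
  conv_rhs => rw [gdist]
  simp only [ENNReal.iInf_add]
  refine le_iInf₂ fun xs hxs => ?_
  refine IsWalk.induct (motive := fun a xs => gdist E a r ≤ walkLen xs + gdist E q r) ?_ ?_ hxs
  · simp [walkLen]
  · intro a b l hab ih
    rw [walkLen_cons_cons, add_assoc]
    exact (gdist_le_edist_add hab).trans (by gcongr)

/-- A function that vanishes on the diagonal, satisfies the triangle inequality and stretches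
every edge by at most `t` stretches every graph distance by at most `t`. -/
theorem le_mul_gdist {f : P → P → ℝ≥0∞} (hself : ∀ a, f a a = 0)
    (htri : ∀ a b c, f a c ≤ f a b + f b c) {t : ℝ≥0∞} (ht₀ : t ≠ 0) (ht : t ≠ ∞)
    (hedge : ∀ a b, s(a, b) ∈ E → f a b ≤ t * edist a b) (p q : P) :
    f p q ≤ t * gdist E p q := by
  simp only [gdist, ENNReal.mul_iInf_of_ne ht₀ ht]
  refine le_iInf₂ fun xs hxs => ?_
  refine IsWalk.induct (motive := fun a xs => f a q ≤ t * walkLen xs) ?_ ?_ hxs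
  · simp [hself]
  · intro a b l hab ih
    rw [walkLen_cons_cons, mul_add]
    exact (htri a b q).trans (add_le_add (hedge a b hab) ih)

theorem gdist_comm (E : Set (Sym2 P)) (p q : P) : gdist E p q = gdist E q p := by
  have key (p q : P) : gdist E q p ≤ gdist E p q := by
    have := le_mul_gdist (E := E) (f := fun a b => gdist E b a) (t := 1) (gdist_self E)
      (fun a b c => by rw [add_comm]; exact gdist_triangle E c b a) (by simp) (by simp)
      (fun a b hab => by
        rw [one_mul, edist_comm]
        exact gdist_le_edist (by rwa [Sym2.eq_swap])) p q
    simpa using this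
  exact le_antisymm (key q p) (key p q)

theorem gdist_le_ofReal_of_le_add {a b x : ℝ} (ha : 0 ≤ a) (hb : 0 ≤ b)
    (h₁ : gdist E p q ≤ ENNReal.ofReal a) (h₂ : gdist E q r ≤ ENNReal.ofReal b)
    (hx : a + b ≤ x) : gdist E p r ≤ ENNReal.ofReal x :=
  calc gdist E p r ≤ ENNReal.ofReal a + ENNReal.ofReal b :=
        (gdist_triangle E p q r).trans (add_le_add h₁ h₂)
    _ = ENNReal.ofReal (a + b) := (ENNReal.ofReal_add ha hb).symm
    _ ≤ ENNReal.ofReal x := ENNReal.ofReal_le_ofReal hx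

end GraphDistance

theorem gdist_le_ofReal_dist {P : Type*} [PseudoMetricSpace P] {E : Set (Sym2 P)} {p q : P}
    (h : s(p, q) ∈ E) : gdist E p q ≤ ENNReal.ofReal (dist p q) :=
  (gdist_le_edist h).trans (edist_dist p q).le

/-- Farthest-point insertion, started from a nonempty set `A`: the radius `lam u` is the distance
from `u` to the points inserted before it. -/
theorem exists_insertion_radius_of_subset {P : Type*} [MetricSpace P] [DecidableEq P]
    (S : Finset P) :
    ∀ (m : ℕ) (A : Finset P), A ⊆ S → A.Nonempty → (S \ A).card = m →
      ∃ lam : P → ℝ, (∀ u ∈ S \ A, ∀ a ∈ A, lam u ≤ dist u a) ∧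
        (∀ u ∈ S \ A, ∀ v ∈ S \ A, u ≠ v → min (lam u) (lam v) ≤ dist u v) ∧
        ∀ p ∈ S, ∀ s > 0, ∃ u ∈ S, dist p u < s ∧ (u ∈ A ∨ s ≤ lam u) := by
  intro m
  induction m with
  | zero =>
    intro A hAS _ hcard
    rw [Finset.card_eq_zero] at hcard
    refine ⟨fun _ => 0, by simp [hcard], by simp [hcard], fun p hp s hs => ⟨p, hp, by simpa, ?_⟩⟩
    exact Or.inl (Finset.sdiff_eq_empty_iff_subset.1 hcard hp)
  | succ m ih =>
    intro A hAS hA hcard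
    choose near hnearA hnear using fun x : P => A.exists_min_image (dist x) hA
    obtain ⟨x, hx, hmax⟩ := (S \ A).exists_max_image (fun x => dist x (near x))
      (Finset.card_pos.1 (by omega))
    obtain ⟨hxS, hxA⟩ := Finset.mem_sdiff.1 hx
    have hcard' : (S \ insert x A).card = m := by
      rw [Finset.sdiff_insert, Finset.card_erase_of_mem hx, hcard, Nat.add_sub_cancel]
    obtain ⟨lam, hlamA, hlam, hcov⟩ := ih (insert x A)
      (Finset.insert_subset hxS hAS) (Finset.insert_nonempty x A) hcard'
    refine ⟨Function.update lam x (dist x (near x)), ?_, ?_, ?_⟩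
    · intro u hu a ha
      by_cases hux : u = x
      · subst hux
        simpa using hnear u a ha
      · rw [Function.update_of_ne hux]
        exact hlamA u (by simp_all) a (Finset.mem_insert_of_mem ha)
    · intro u hu v hv huv
      by_cases hux : u = x
      · subst hux
        rw [Function.update_of_ne huv.symm, dist_comm u v]
        exact (min_le_right _ _).trans
          (hlamA v (by simp_all [eq_comm]) u (Finset.mem_insert_self u A))
      · rw [Function.update_of_ne hux]
        by_cases hvx : v = x
        · subst hvx
          exact (min_le_left _ _).trans
            (hlamA u (by simp_all) v (Finset.mem_insert_self v A))
        · rw [Function.update_of_ne hvx]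
          exact hlam u (by simp_all) v (by simp_all) huv
    · intro p hp s hs
      obtain ⟨u, huS, hpu, hu⟩ := hcov p hp s hs
      by_cases huA : u ∈ A
      · exact ⟨u, huS, hpu, Or.inl huA⟩
      by_cases hux : u = x
      · subst hux
        by_cases hs' : s ≤ dist u (near u)
        · exact ⟨u, huS, hpu, Or.inr (by simpa using hs')⟩
        by_cases hpA : p ∈ A
        · exact ⟨p, hp, by simpa, Or.inl hpA⟩
        · exact ⟨near p, hAS (hnearA p),
            (hmax p (Finset.mem_sdiff.2 ⟨hp, hpA⟩)).trans_lt (not_le.1 hs'), Or.inl (hnearA p)⟩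
      · refine ⟨u, huS, hpu, Or.inr ?_⟩
        rw [Function.update_of_ne hux]
        simpa [hux, huA] using hu

/-- A finite metric space has a radius function whose superlevel sets `{u | s ≤ lam u}` are
`s`-separated and `s`-dense, for all scales `s` up to a prescribed bound `D`. -/
theorem exists_insertion_radius {P : Type*} [MetricSpace P] (S : Finset P) (D : ℝ) :
    ∃ lam : P → ℝ, (∀ u ∈ S, ∀ v ∈ S, u ≠ v → min (lam u) (lam v) ≤ dist u v) ∧
      ∀ p ∈ S, ∀ s, 0 < s → s ≤ D → ∃ u ∈ S, dist p u < s ∧ s ≤ lam u := by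
  classical
  obtain rfl | ⟨x, hx⟩ := S.eq_empty_or_nonempty
  · simp
  obtain ⟨lam, hlamx, hlam, hcov⟩ := exists_insertion_radius_of_subset S _ {x}
    (by simpa using hx) (by simp) rfl
  refine ⟨Function.update lam x D, ?_, ?_⟩
  · intro u hu v hv huv
    by_cases hux : u = x
    · subst hux
      rw [Function.update_of_ne huv.symm, dist_comm u v]
      exact (min_le_right _ _).trans (hlamx v (by simp_all [eq_comm]) u (by simp))
    · rw [Function.update_of_ne hux]
      by_cases hvx : v = x
      · subst hvx
        exact (min_le_left _ _).trans (hlamx u (by simp_all) v (by simp))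
      · rw [Function.update_of_ne hvx]
        exact hlam u (by simp_all) v (by simp_all) huv
  · intro p hp s hs hsD
    obtain ⟨u, huS, hpu, hu⟩ := hcov p hp s hs
    refine ⟨u, huS, hpu, ?_⟩
    by_cases hux : u = x
    · simpa [hux] using hsD
    · rw [Function.update_of_ne hux]
      simpa [hux] using hu

/-- Packing bound: boundedly many points at mutual distance at least `r` fit into a ball of
radius `K * r`. -/
theorem exists_packing_bound (V : Type*) [NormedAddCommGroup V] [NormedSpace ℝ V] [ProperSpace V]
    (K : ℝ) : ∃ M : ℕ, ∀ (r : ℝ), 0 < r → ∀ (x : V) (F : Finset V),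
      (∀ v ∈ F, dist x v ≤ K * r) → (∀ v ∈ F, ∀ w ∈ F, v ≠ w → r ≤ dist v w) → F.card ≤ M := by
  classical
  obtain ⟨T, hTfin, hT⟩ := Metric.totallyBounded_iff.1
    (isCompact_closedBall (0 : V) K).totallyBounded (1 / 2) (by norm_num)
  refine ⟨hTfin.toFinset.card, fun r hr x F hF hsep => ?_⟩
  have hcenter : ∀ v ∈ F, ∃ y ∈ T, dist (r⁻¹ • (v - x)) y < 1 / 2 := by
    intro v hv
    have hmem : r⁻¹ • (v - x) ∈ Metric.closedBall (0 : V) K := by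
      rw [mem_closedBall_zero_iff, norm_smul, norm_inv, Real.norm_of_nonneg hr.le, ← dist_eq_norm,
        dist_comm, inv_mul_le_iff₀ hr, mul_comm]
      exact hF v hv
    simpa using hT hmem
  choose! y hyT hy using hcenter
  refine Finset.card_le_card_of_injOn y (fun v hv => by simpa using hyT v hv) ?_
  intro v hv w hw hvw
  by_contra hne
  have h₁ := hy v hv
  have h₂ := hy w hw
  rw [← hvw] at h₂
  have h₃ : dist (r⁻¹ • (v - x)) (r⁻¹ • (w - x)) < 1 :=
    (dist_triangle_right _ _ (y v)).trans_lt (by linarith)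
  rw [dist_smul₀, dist_sub_right, norm_inv, Real.norm_of_nonneg hr.le, inv_mul_lt_iff₀ hr,
    mul_one] at h₃
  exact absurd (hsep v hv w hw hne) (not_le.2 h₃)

/-- Only linearly many pairs of points are close relative to both of their radii. -/
theorem card_close_pairs_le {P : Type*} [MetricSpace P] {S : Finset P} {lam : P → ℝ} {K : ℝ}
    (hK : 0 ≤ K) (hsep : ∀ u ∈ S, ∀ v ∈ S, u ≠ v → min (lam u) (lam v) ≤ dist u v) {M : ℕ}
    (hM : ∀ (r : ℝ), 0 < r → ∀ (x : P) (F : Finset P), (∀ v ∈ F, dist x v ≤ K * r) →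
      (∀ v ∈ F, ∀ w ∈ F, v ≠ w → r ≤ dist v w) → F.card ≤ M)
    {Q : Finset (P × P)} (hQS : Q ⊆ S ×ˢ S)
    (hQ : ∀ e ∈ Q, dist e.1 e.2 ≤ K * lam e.1 ∧ dist e.1 e.2 ≤ K * lam e.2) :
    Q.card ≤ 2 * (S.card * (M + 1)) := by
  classical
  have hnear (u : P) (hu : u ∈ S) :
      (S.filter fun v => dist u v ≤ K * lam u ∧ lam u ≤ lam v).card ≤ M + 1 := by
    obtain hpos | hneg := lt_or_ge 0 (lam u)
    · refine (hM (lam u) hpos u _ (fun v hv => (Finset.mem_filter.1 hv).2.1) ?_).trans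
        (Nat.le_succ M)
      intro v hv w hw hvw
      rw [Finset.mem_filter] at hv hw
      exact (le_min hv.2.2 hw.2.2).trans (hsep v hv.1 w hw.1 hvw)
    · refine (Finset.card_le_one.2 ?_).trans (Nat.le_add_left 1 M)
      have heq : ∀ v ∈ S.filter (fun v => dist u v ≤ K * lam u ∧ lam u ≤ lam v), u = v :=
        fun v hv => dist_le_zero.1 ((Finset.mem_filter.1 hv).2.1.trans
          (mul_nonpos_of_nonneg_of_nonpos hK hneg))
      intro v hv w hw
      rw [← heq v hv, ← heq w hw]
  have hsub : Q ⊆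
      (S.biUnion fun u => (S.filter fun v => dist u v ≤ K * lam u ∧ lam u ≤ lam v).image
        fun v => (u, v)) ∪
      (S.biUnion fun u => (S.filter fun v => dist u v ≤ K * lam u ∧ lam u ≤ lam v).image
        fun v => (v, u)) := by
    rintro ⟨u, v⟩ huv
    obtain ⟨hu, hv⟩ := Finset.mem_product.1 (hQS huv)
    obtain ⟨h₁, h₂⟩ := hQ _ huv
    simp only at hu hv h₁ h₂
    rw [Finset.mem_union]
    obtain h | h := le_total (lam u) (lam v)
    · left
      simp only [Finset.mem_biUnion, Finset.mem_image, Finset.mem_filter]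
      exact ⟨u, hu, v, ⟨hv, h₁, h⟩, rfl⟩
    · right
      simp only [Finset.mem_biUnion, Finset.mem_image, Finset.mem_filter]
      exact ⟨v, hv, u, ⟨hu, by rwa [dist_comm], h⟩, rfl⟩
  refine (Finset.card_le_card hsub).trans ((Finset.card_union_le _ _).trans ?_)
  rw [two_mul]
  exact add_le_add
    (Finset.card_biUnion_le_card_mul _ _ _ fun u hu => Finset.card_image_le.trans (hnear u hu))
    (Finset.card_biUnion_le_card_mul _ _ _ fun u hu => Finset.card_image_le.trans (hnear u hu))

section Stretch

variable {P κ : Type*} [MetricSpace P] {S : Finset P} {c : P → κ} {nn rep : P → P} {lam : P → ℝ}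
  {D : ℝ} {E : Set (Sym2 P)}

/-- At the scale `ℓ` of an edge at `p`, some point `u` of large radius lies close to `p` and can
be reached cheaply from `p`; it has the color of `p`, unless its neighbor `nn u` of another
color can be used in its place. -/
theorem exists_hub
    (hnnS : ∀ p ∈ S, nn p ∈ S) (hnnc : ∀ p ∈ S, c (nn p) ≠ c p)
    (hnn : ∀ p ∈ S, ∀ q ∈ S, c q ≠ c p → dist p (nn p) ≤ dist p q)
    (hcov : ∀ p ∈ S, ∀ s, 0 < s → s ≤ D → ∃ u ∈ S, dist p u < s ∧ s ≤ lam u)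
    (hrepS : ∀ p ∈ S, rep p ∈ S)
    (hrep : ∀ p ∈ S, dist p (rep p) < 1 / 100 * dist p (nn p))
    (hreplam : ∀ p ∈ S, 1 / 100 * dist p (nn p) ≤ lam (rep p))
    (hEnn : ∀ p ∈ S, s(p, nn p) ∈ E)
    (hErep : ∀ p ∈ S, s(p, nn (rep p)) ∈ E)
    {ℓ : ℝ} (hℓ : 0 < ℓ) (hℓD : ℓ ≤ D)
    (ih : ∀ a ∈ S, ∀ b ∈ S, c a ≠ c b → dist a b < ℓ →
      gdist E a b ≤ ENNReal.ofReal (6 * dist a b))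
    {p : P} (hp : p ∈ S) (hpℓ : dist p (nn p) ≤ ℓ) :
    ∃ u ∈ S, 1 / 10000 * ℓ ≤ lam u ∧ dist p u ≤ 1 / 100 * ℓ ∧
      gdist E p u ≤ ENNReal.ofReal (203 / 100 * ℓ) ∧
      (c u = c p ∨
        (gdist E p (nn u) ≤ ENNReal.ofReal (203 / 100 * ℓ) ∧ dist u (nn u) ≤ 2 / 100 * ℓ)) := by
  obtain hfar | hclose := le_or_gt (1 / 100 * ℓ) (dist p (nn p))
  · have hu := hrepS p hp
    have hpu := hrep p hp
    have hr : 0 < dist p (nn p) := by linarith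
    have hcol : c (rep p) = c p := by
      by_contra hne
      linarith [hnn p hp _ hu hne]
    have h₁ : dist (rep p) (nn (rep p)) ≤ dist p (rep p) + dist p (nn p) :=
      (hnn _ hu _ (hnnS p hp) (by rw [hcol]; exact hnnc p hp)).trans (dist_triangle_left _ _ _)
    have h₂ := dist_triangle p (rep p) (nn (rep p))
    refine ⟨rep p, hu, by linarith [hreplam p hp], by linarith, ?_, Or.inl hcol⟩
    refine gdist_le_ofReal_of_le_add dist_nonneg dist_nonneg
      (gdist_le_ofReal_dist (hErep p hp)) ?_ (?_ : _ + dist (rep p) (nn (rep p)) ≤ _)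
    · rw [gdist_comm]
      exact gdist_le_ofReal_dist (hEnn _ hu)
    · linarith
  · obtain ⟨u, hu, hpu, hlam⟩ := hcov p hp (1 / 100 * ℓ) (by linarith) (by linarith)
    have hreach (w : P) (hw : w ∈ S) (hpw : dist p w ≤ 3 / 100 * ℓ) :
        gdist E p w ≤ ENNReal.ofReal (203 / 100 * ℓ) := by
      by_cases hcw : c p = c w
      · have h := dist_triangle_left (nn p) w p
        refine gdist_le_ofReal_of_le_add dist_nonneg (by positivity)
          (gdist_le_ofReal_dist (hEnn p hp))
          (ih _ (hnnS p hp) w hw (by rw [← hcw]; exact hnnc p hp) (by linarith)) ?_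
        linarith
      · exact (ih p hp w hw hcw (by linarith)).trans (ENNReal.ofReal_le_ofReal (by linarith))
    have hnnu : dist u (nn u) ≤ 2 / 100 * ℓ := by
      by_cases hcu : c p = c u
      · have h := hnn u hu _ (hnnS p hp) (by rw [← hcu]; exact hnnc p hp)
        linarith [dist_triangle_left u (nn p) p]
      · have h := hnn u hu p hp hcu
        rw [dist_comm u p] at h
        linarith
    exact ⟨u, hu, by linarith, hpu.le, hreach u hu (by linarith),
      Or.inr ⟨hreach _ (hnnS u hu) (by linarith [dist_triangle p u (nn u)]), hnnu⟩⟩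

/-- Joining hubs of large radius that lie close to each other, directly or through a neighbor of
another color, gives stretch `6` on every pair of distinct colors. -/
theorem gdist_le_of_hubs
    (hnnS : ∀ p ∈ S, nn p ∈ S) (hnnc : ∀ p ∈ S, c (nn p) ≠ c p)
    (hnn : ∀ p ∈ S, ∀ q ∈ S, c q ≠ c p → dist p (nn p) ≤ dist p q)
    (hcov : ∀ p ∈ S, ∀ s, 0 < s → s ≤ D → ∃ u ∈ S, dist p u < s ∧ s ≤ lam u)
    (hD : ∀ p ∈ S, ∀ q ∈ S, dist p q ≤ D)
    (hrepS : ∀ p ∈ S, rep p ∈ S)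
    (hrep : ∀ p ∈ S, dist p (rep p) < 1 / 100 * dist p (nn p))
    (hreplam : ∀ p ∈ S, 1 / 100 * dist p (nn p) ≤ lam (rep p))
    (hEnn : ∀ p ∈ S, s(p, nn p) ∈ E)
    (hErep : ∀ p ∈ S, s(p, nn (rep p)) ∈ E)
    (hE : ∀ u ∈ S, ∀ v ∈ S, dist u v ≤ 20000 * lam u → dist u v ≤ 20000 * lam v →
      c u ≠ c v → s(u, v) ∈ E)
    (hE' : ∀ u ∈ S, ∀ v ∈ S, dist u v ≤ 20000 * lam u → dist u v ≤ 20000 * lam v →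
      c u ≠ c (nn v) → s(u, nn v) ∈ E)
    {p q : P} (hp : p ∈ S) (hq : q ∈ S) (hpq : c p ≠ c q) :
    gdist E p q ≤ ENNReal.ofReal (6 * dist p q) := by
  classical
  by_contra hbad
  let B := (S ×ˢ S).filter fun e =>
    c e.1 ≠ c e.2 ∧ ¬ gdist E e.1 e.2 ≤ ENNReal.ofReal (6 * dist e.1 e.2)
  have hB (a b : P) : (a, b) ∈ B ↔
      (a ∈ S ∧ b ∈ S) ∧ c a ≠ c b ∧ ¬ gdist E a b ≤ ENNReal.ofReal (6 * dist a b) := by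
    simp [B]
  obtain ⟨⟨p, q⟩, hmem, hmin⟩ := B.exists_min_image (fun e => dist e.1 e.2)
    ⟨(p, q), (hB p q).2 ⟨⟨hp, hq⟩, hpq, hbad⟩⟩
  obtain ⟨⟨hp, hq⟩, hpq, hbad⟩ := (hB p q).1 hmem
  refine hbad ?_
  simp only at hmin
  have ih : ∀ a ∈ S, ∀ b ∈ S, c a ≠ c b → dist a b < dist p q →
      gdist E a b ≤ ENNReal.ofReal (6 * dist a b) := by
    intro a ha b hb hab hlt
    by_contra h
    exact absurd (hmin (a, b) ((hB a b).2 ⟨⟨ha, hb⟩, hab, h⟩)) (not_le.2 hlt)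
  have hℓ : 0 < dist p q := dist_pos.2 fun h => hpq (by rw [h])
  have hub := fun {x : P} => exists_hub (p := x) hnnS hnnc hnn hcov hrepS hrep hreplam hEnn hErep
    hℓ (hD p hp q hq) ih
  obtain ⟨u, hu, hulam, hpu, hgu, hucol⟩ := hub hp (hnn p hp q hq hpq.symm)
  obtain ⟨v, hv, hvlam, hqv, hgv, hvcol⟩ :=
    hub hq (by simpa [dist_comm] using hnn q hq p hp hpq)
  have huv : dist u v ≤ 102 / 100 * dist p q := by
    have h₁ := dist_triangle4 u p q v
    rw [dist_comm u p] at h₁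
    linarith
  have hu' : dist u v ≤ 20000 * lam u := by linarith
  have hv' : dist u v ≤ 20000 * lam v := by linarith
  have finish {x y : P} (hx : gdist E p x ≤ ENNReal.ofReal (203 / 100 * dist p q))
      (hy : gdist E q y ≤ ENNReal.ofReal (203 / 100 * dist p q)) (hxy : s(x, y) ∈ E)
      (hd : dist x y ≤ 104 / 100 * dist p q) :
      gdist E p q ≤ ENNReal.ofReal (6 * dist p q) := by
    rw [gdist_comm E q y] at hy
    refine gdist_le_ofReal_of_le_add (by positivity) (by positivity)
      (gdist_le_ofReal_of_le_add (by positivity) dist_nonneg hx (gdist_le_ofReal_dist hxy) le_rfl)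
      hy ?_
    linarith
  by_cases huvc : c u = c v
  · obtain hvc | ⟨hgv', hdv⟩ := hvcol
    · obtain huc | ⟨hgu', hdu⟩ := hucol
      · exact absurd (by rw [← huc, huvc, hvc]) hpq
      · refine finish hgu' hgv ?_ ?_
        · rw [Sym2.eq_swap]
          rw [dist_comm] at hu' hv'
          exact hE' v hv u hu hv' hu' (by rw [← huvc]; exact (hnnc u hu).symm)
        · linarith [dist_triangle_left (nn u) v u]
    · refine finish hgu hgv' (hE' u hu v hv hu' hv' ?_) ?_
      · rw [huvc]
        exact (hnnc v hv).symm
      · linarith [dist_triangle u v (nn v)]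
  · exact finish hgu hgv (hE u hu v hv hu' hv' huvc) (by linarith)

end Stretch

/-- In a metric space with a packing bound, the complete multipartite geometric graph of any
coloring of a finite set has a `6`-spanner of linear size. -/
theorem exists_multipartite_spanner {P κ : Type*} [MetricSpace P] {M : ℕ}
    (hM : ∀ (r : ℝ), 0 < r → ∀ (x : P) (F : Finset P), (∀ v ∈ F, dist x v ≤ 20000 * r) →
      (∀ v ∈ F, ∀ w ∈ F, v ≠ w → r ≤ dist v w) → F.card ≤ M)
    (S : Finset P) (c : P → κ) :
    ∃ E : Finset (Sym2 P), (∀ e ∈ E, ∃ p ∈ S, ∃ q ∈ S, c p ≠ c q ∧ e = s(p, q)) ∧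
      E.card ≤ (4 * M + 6) * S.card ∧
      ∀ p ∈ S, ∀ q ∈ S, c p ≠ c q →
        gdist (↑E : Set (Sym2 P)) p q ≤ ENNReal.ofReal (6 * dist p q) := by
  classical
  by_cases hmono : ∀ p ∈ S, ∀ q ∈ S, c p = c q
  · exact ⟨∅, by simp, by simp, fun p hp q hq hpq => absurd (hmono p hp q hq) hpq⟩
  push Not at hmono
  obtain ⟨x, hx, y, hy, hxy⟩ := hmono
  have hother : ∀ p ∈ S, ∃ z ∈ S, c z ≠ c p ∧ ∀ q ∈ S, c q ≠ c p → dist p z ≤ dist p q := by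
    intro p hp
    have hne : (S.filter fun q => c q ≠ c p).Nonempty := by
      by_cases h : c x = c p
      · exact ⟨y, Finset.mem_filter.2 ⟨hy, by rw [← h]; exact hxy.symm⟩⟩
      · exact ⟨x, Finset.mem_filter.2 ⟨hx, h⟩⟩
    obtain ⟨z, hz, hmin⟩ := Finset.exists_min_image _ (dist p) hne
    rw [Finset.mem_filter] at hz
    exact ⟨z, hz.1, hz.2, fun q hq hqp => hmin q (Finset.mem_filter.2 ⟨hq, hqp⟩)⟩
  choose! nn hnnS hnnc hnn using hother
  obtain ⟨D, hD⟩ := Metric.isBounded_iff.1 S.finite_toSet.isBounded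
  obtain ⟨lam, hsep, hcov⟩ := exists_insertion_radius S D
  have hpos : ∀ p ∈ S, 0 < dist p (nn p) :=
    fun p hp => dist_pos.2 fun h => hnnc p hp (by rw [← h])
  have hrep : ∀ p ∈ S, ∃ u ∈ S, dist p u < 1 / 100 * dist p (nn p) ∧
      1 / 100 * dist p (nn p) ≤ lam u := fun p hp =>
    hcov p hp _ (by linarith [hpos p hp]) (by linarith [hpos p hp, hD hp (hnnS p hp)])
  choose! rep hrepS hrep hreplam using hrep
  have hrepc : ∀ p ∈ S, c (rep p) = c p := by
    intro p hp
    by_contra hne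
    linarith [hnn p hp _ (hrepS p hp) hne, hrep p hp, hpos p hp]
  let Q := (S ×ˢ S).filter fun e =>
    dist e.1 e.2 ≤ 20000 * lam e.1 ∧ dist e.1 e.2 ≤ 20000 * lam e.2
  have hQcard : Q.card ≤ 2 * (S.card * (M + 1)) :=
    card_close_pairs_le (by norm_num) hsep hM (Finset.filter_subset _ _)
      fun e he => (Finset.mem_filter.1 he).2
  have hQ (u : P) (hu : u ∈ S) (v : P) (hv : v ∈ S) (h₁ : dist u v ≤ 20000 * lam u)
      (h₂ : dist u v ≤ 20000 * lam v) : (u, v) ∈ Q :=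
    Finset.mem_filter.2 ⟨Finset.mem_product.2 ⟨hu, hv⟩, h₁, h₂⟩
  let E := S.image (fun p => s(p, nn p)) ∪ S.image (fun p => s(p, nn (rep p))) ∪
    (Q.image (fun e => s(e.1, e.2)) ∪ Q.image fun e => s(e.1, nn e.2))
  let proper : Sym2 P → Prop := fun e => ∃ p ∈ S, ∃ q ∈ S, c p ≠ c q ∧ e = s(p, q)
  have hmem {e : Sym2 P} (he : e ∈ E) (hpr : proper e) :
      e ∈ (↑(E.filter proper) : Set (Sym2 P)) :=
    Finset.mem_coe.2 (Finset.mem_filter.2 ⟨he, hpr⟩)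
  refine ⟨E.filter proper, fun e he => (Finset.mem_filter.1 he).2, ?_, ?_⟩
  · have hcard : E.card ≤ S.card + S.card + (Q.card + Q.card) :=
      (Finset.card_union_le _ _).trans (add_le_add
        ((Finset.card_union_le _ _).trans (add_le_add Finset.card_image_le Finset.card_image_le))
        ((Finset.card_union_le _ _).trans (add_le_add Finset.card_image_le Finset.card_image_le)))
    refine (Finset.card_filter_le _ _).trans (hcard.trans ?_)
    linarith
  · intro p hp q hq hpq
    refine gdist_le_of_hubs hnnS hnnc hnn hcov (fun p hp q hq => hD hp hq) hrepS hrep hreplam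
      ?_ ?_ ?_ ?_ hp hq hpq
    · intro p hp
      refine hmem (Finset.mem_union_left _ (Finset.mem_union_left _
        (Finset.mem_image_of_mem _ hp))) ?_
      exact ⟨p, hp, nn p, hnnS p hp, (hnnc p hp).symm, rfl⟩
    · intro p hp
      refine hmem (Finset.mem_union_left _ (Finset.mem_union_right _
        (Finset.mem_image.2 ⟨p, hp, rfl⟩))) ?_
      refine ⟨p, hp, nn (rep p), hnnS _ (hrepS p hp), ?_, rfl⟩
      rw [← hrepc p hp]
      exact (hnnc _ (hrepS p hp)).symm
    · intro u hu v hv h₁ h₂ huv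
      exact hmem (Finset.mem_union_right _ (Finset.mem_union_left _
        (Finset.mem_image.2 ⟨(u, v), hQ u hu v hv h₁ h₂, rfl⟩))) ⟨u, hu, v, hv, huv, rfl⟩
    · intro u hu v hv h₁ h₂ huv
      exact hmem (Finset.mem_union_right _ (Finset.mem_union_right _
        (Finset.mem_image.2 ⟨(u, v), hQ u hu v hv h₁ h₂, rfl⟩)))
        ⟨u, hu, nn v, hnnS v hv, huv, rfl⟩

/-- Disjoint classes covering `S` come from a coloring of the points. -/
theorem exists_coloring {P : Type*} {k : ℕ} (hk : 0 < k) {S : Set P} {Cl : Fin k → Set P}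
    (hdisj : ∀ i j, i ≠ j → Disjoint (Cl i) (Cl j)) (hunion : (⋃ i, Cl i) = S) :
    ∃ c : P → Fin k, ∀ x i, x ∈ Cl i ↔ x ∈ S ∧ c x = i := by
  subst hunion
  have : Nonempty (Fin k) := ⟨⟨0, hk⟩⟩
  have hex : ∀ x ∈ ⋃ i, Cl i, ∃ i, x ∈ Cl i := fun x hx => Set.mem_iUnion.1 hx
  choose! c hc using hex
  refine ⟨c, fun x i => ⟨fun hx => ?_, fun ⟨hx, hi⟩ => hi ▸ hc x hx⟩⟩
  have hxU : x ∈ ⋃ i, Cl i := Set.mem_iUnion.2 ⟨i, hx⟩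
  refine ⟨hxU, ?_⟩
  by_contra hne
  exact Set.disjoint_left.1 (hdisj _ _ hne) (hc x hxU) hx

/-- For every dimension `d ≥ 1` and every stretch factor
`t > 8·√d·(d·⌈(1/2)·log₂ d⌉ + d + 1) + 1` there is a constant `C` such that for
every `k ≥ 2`, every finite set `S` of `n` points in `ℝ^d` and every partition
of `S` into `k` subsets, the complete `k`-partite geometric graph on `S` has a
`t`-spanner with at most `C·n` edges. -/
theorem const_stretch_spanner (d : ℕ) (hd : 1 ≤ d) (t : ℝ)
    (ht : 8 * Real.sqrt d *
        ((d : ℝ) * ((⌈(1 / 2 : ℝ) * Real.logb 2 d⌉ : ℤ) : ℝ) + d + 1) + 1 < t) :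
    ∃ C : ℝ, ∀ k : ℕ, 2 ≤ k →
      ∀ (S : Finset (EuclideanSpace ℝ (Fin d)))
        (Cl : Fin k → Set (EuclideanSpace ℝ (Fin d))),
        (∀ i j, i ≠ j → Disjoint (Cl i) (Cl j)) →
        (⋃ i, Cl i) = ↑S →
        ∃ E : Finset (Sym2 (EuclideanSpace ℝ (Fin d))),
          (↑E : Set (Sym2 (EuclideanSpace ℝ (Fin d)))) ⊆ kpartiteEdges Cl ∧
          (E.card : ℝ) ≤ C * S.card ∧
          ∀ p ∈ S, ∀ q ∈ S,
            gdist (↑E : Set (Sym2 (EuclideanSpace ℝ (Fin d)))) p q ≤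
              ENNReal.ofReal t * gdist (kpartiteEdges Cl) p q := by
  have hdR : (1 : ℝ) ≤ d := by exact_mod_cast hd
  have hsqrt : 1 ≤ Real.sqrt d := Real.one_le_sqrt.2 hdR
  have hceil : (0 : ℝ) ≤ ((⌈(1 / 2 : ℝ) * Real.logb 2 d⌉ : ℤ) : ℝ) := by
    exact_mod_cast Int.ceil_nonneg (mul_nonneg (by norm_num) (Real.logb_nonneg (by norm_num) hdR))
  have ht6 : 6 ≤ t := by
    have h := mul_nonneg (by linarith : (0 : ℝ) ≤ d) hceil
    nlinarith
  obtain ⟨M, hM⟩ := exists_packing_bound (EuclideanSpace ℝ (Fin d)) 20000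
  refine ⟨4 * M + 6, fun k hk S Cl hdisj hunion => ?_⟩
  obtain ⟨c, hc⟩ := exists_coloring (by omega) hdisj hunion
  obtain ⟨E, hE, hcard, hstretch⟩ := exists_multipartite_spanner hM S c
  refine ⟨E, ?_, by exact_mod_cast hcard, fun p _ q _ => ?_⟩
  · intro e he
    obtain ⟨p, hp, q, hq, hpq, rfl⟩ := hE e he
    exact ⟨p, q, rfl, c p, c q, hpq, (hc p _).2 ⟨hp, rfl⟩, (hc q _).2 ⟨hq, rfl⟩⟩
  · refine le_mul_gdist (gdist_self _) (gdist_triangle _)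
      (ENNReal.ofReal_pos.2 (by linarith)).ne' ENNReal.ofReal_ne_top ?_ p q
    rintro a b ⟨x, y, hxy, i, j, hij, hx, hy⟩
    have key : gdist (↑E : Set (Sym2 (EuclideanSpace ℝ (Fin d)))) x y ≤
        ENNReal.ofReal t * edist x y := by
      obtain ⟨hxS, rfl⟩ := (hc x i).1 hx
      obtain ⟨hyS, rfl⟩ := (hc y j).1 hy
      rw [edist_dist, ← ENNReal.ofReal_mul (by linarith)]
      exact (hstretch x hxS y hyS hij).trans (ENNReal.ofReal_le_ofReal (by gcongr))
    obtain ⟨rfl, rfl⟩ | ⟨rfl, rfl⟩ := Sym2.eq_iff.1 hxy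
    · exact key
    · rwa [gdist_comm, edist_comm]
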